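/- arXiv:1911.04226 — 3 statements merged into one kernel-verified Lean document; each statement's English description precedes it below -/
import Mathlib

section
/- Fix α ≥ 0, κ ≥ 0, r_max^I ≥ 0, r_max^II ≥ 0, λ^I, λ^II, ρ^I, ρ^II ∈ ℕ, and set ε = α·( min{3λ^I, λ^I+ρ^I}·(r_max^I+κ)² + min{3λ^II, λ^II+ρ^II}·(r_max^II+κ)² ). Let (Θ, 𝒜, μ) be a measure space with a measurable prior density h : Θ → [0,∞). Let O^I, O'^I (respectively O^II, O'^II) be finite index sets of observed entries of the transition-count (respectively visit-count) tensor for two neighboring training sets, with observed counts r^I_i, r'^I_i ∈ [0, r_max^I] and r^II_j, r'^II_j ∈ [0, r_max^II], and with measurable reconstruction maps r̂^I_i, r̂^II_j : Θ → ℝ satisfying r̂^I_i(θ) ∈ [−κ, r_max^I+κ] and r̂^II_j(θ) ∈ [−κ, r_max^II+κ] for all θ ∈ Θ. Define G(θ) = Σ_{i∈O^I} (α/2)(r^I_i − r̂^I_i(θ))² + Σ_{j∈O^II} (α/2)(r^II_j − r̂^II_j(θ))², and G'(θ) analogously with the primed index sets and counts. Assume that the set of indices i ∈ O^I ∪ O'^I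 whose summand differs between G and G' (i.e., i lies in exactly one of O^I, O'^I, or i ∈ O^I ∩ O'^I with r^I_i ≠ r'^I_i) has cardinality at most min{3λ^I, λ^I+ρ^I}, and that the analogous set for the second tensor has cardinality at most min{3λ^II, λ^II+ρ^II}. If 0 < ∫_Θ exp(−G)·h dμ < ∞ and 0 < ∫_Θ exp(−G')·h dμ < ∞, then the posterior probabilities p(Z) = (∫_Z exp(−G)·h dμ)/(∫_Θ exp(−G)·h dμ) and p'(Z) = (∫_Z exp(−G')·h dμ)/(∫_Θ exp(−G')·h dμ) satisfy e^{−ε}·p'(Z) ≤ p(Z) ≤ e^{ε}·p'(Z) for every measurable Z ⊆ Θ. -/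
open MeasureTheory

lemma abs_sum_sub_sum_le_ncard_mul {ι : Type*} [DecidableEq ι] (s t : Finset ι) (f g : ι → ℝ)
    {B : ℝ} (hf : ∀ i ∈ s, f i ∈ Set.Icc 0 B) (hg : ∀ i ∈ t, g i ∈ Set.Icc 0 B) {P : ι → Prop}
    (hP : ∀ i, i ∈ s → i ∈ t → ¬P i → f i = g i) :
    |∑ i ∈ s, f i - ∑ i ∈ t, g i| ≤
      ({i | i ∈ s ∪ t ∧ (¬(i ∈ s ∧ i ∈ t) ∨ P i)}.ncard : ℝ) * B := by
  classical
  have hs : ∑ i ∈ s, f i = ∑ i ∈ s ∪ t, if i ∈ s then f i else 0 := by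
    rw [Finset.sum_ite_mem, Finset.union_inter_cancel_left]
  have ht : ∑ i ∈ t, g i = ∑ i ∈ s ∪ t, if i ∈ t then g i else 0 := by
    rw [Finset.sum_ite_mem, Finset.union_inter_cancel_right]
  have hcard : {i | i ∈ s ∪ t ∧ (¬(i ∈ s ∧ i ∈ t) ∨ P i)}.ncard =
      ((s ∪ t).filter fun i => ¬(i ∈ s ∧ i ∈ t) ∨ P i).card := by
    rw [← Set.ncard_coe_finset]
    congr 1
    ext i
    simp
  rw [hs, ht, ← Finset.sum_sub_distrib, hcard, ← nsmul_eq_mul, ← Finset.sum_const,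
    Finset.sum_filter]
  refine (Finset.abs_sum_le_sum_abs _ _).trans (Finset.sum_le_sum fun i hi => ?_)
  rw [abs_le]
  by_cases his : i ∈ s <;> by_cases hit : i ∈ t
  · obtain ⟨hf0, hfB⟩ := hf i his
    obtain ⟨hg0, hgB⟩ := hg i hit
    by_cases hPi : P i
    · simp only [his, hit, hPi, if_true, or_true]
      constructor <;> linarith
    · simp [his, hit, hPi, hP i his hit hPi]
  · obtain ⟨hf0, hfB⟩ := hf i his
    simp only [his, hit, if_true, if_false, and_false, not_false_eq_true, true_or]
    constructor <;> linarith
  · obtain ⟨hg0, hgB⟩ := hg i hit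
    simp only [his, hit, if_true, if_false, false_and, not_false_eq_true, true_or]
    constructor <;> linarith
  · simp_all

lemma half_mul_sub_sq_mem_Icc {α κ R r x : ℝ} (hα : 0 ≤ α)
    (hr : r ∈ Set.Icc 0 R) (hx : x ∈ Set.Icc (-κ) (R + κ)) :
    α / 2 * (r - x) ^ 2 ∈ Set.Icc 0 (α / 2 * (R + κ) ^ 2) := by
  obtain ⟨hr0, hrR⟩ := hr
  obtain ⟨hx0, hxR⟩ := hx
  refine ⟨by positivity, mul_le_mul_of_nonneg_left (sq_le_sq' ?_ ?_) (by positivity)⟩ <;> linarith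

/-- Two Gaussian negative log-likelihoods with `n` differing observations differ by at most
`n * (α / 2 * (R + κ) ^ 2)`. -/
lemma abs_sum_half_mul_sub_sq_sub_le {ι : Type*} [DecidableEq ι] {α κ R : ℝ} (hα : 0 ≤ α)
    {s t : Finset ι} {r r' x : ι → ℝ} (hr : ∀ i ∈ s, r i ∈ Set.Icc 0 R)
    (hr' : ∀ i ∈ t, r' i ∈ Set.Icc 0 R) (hx : ∀ i, x i ∈ Set.Icc (-κ) (R + κ)) {n : ℕ}
    (hn : {i | i ∈ s ∪ t ∧ (¬(i ∈ s ∧ i ∈ t) ∨ r i ≠ r' i)}.ncard ≤ n) :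
    |∑ i ∈ s, α / 2 * (r i - x i) ^ 2 - ∑ i ∈ t, α / 2 * (r' i - x i) ^ 2| ≤
      n * (α / 2 * (R + κ) ^ 2) := by
  refine (abs_sum_sub_sum_le_ncard_mul s t _ _ (B := α / 2 * (R + κ) ^ 2)
    (fun i hi => half_mul_sub_sq_mem_Icc hα (hr i hi) (hx i))
    (fun i hi => half_mul_sub_sq_mem_Icc hα (hr' i hi) (hx i))
    (P := fun i => r i ≠ r' i) fun i _ _ h => by rw [not_not.mp h]).trans ?_
  gcongr

lemma setLIntegral_div_lintegral_le {Θ : Type*} [MeasurableSpace Θ] (μ : Measure Θ)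
    {v w : Θ → ENNReal} {c : ENNReal} (hc0 : c ≠ 0) (hc : c ≠ ⊤)
    (hvw : ∀ θ, v θ ≤ c * w θ) (hwv : ∀ θ, w θ ≤ c * v θ) (Z : Set Θ) :
    (∫⁻ θ in Z, v θ ∂μ) / (∫⁻ θ, v θ ∂μ) ≤
      c * c * ((∫⁻ θ in Z, w θ ∂μ) / (∫⁻ θ, w θ ∂μ)) := by
  have hnum : ∫⁻ θ in Z, v θ ∂μ ≤ c * ∫⁻ θ in Z, w θ ∂μ := by
    rw [← lintegral_const_mul' _ _ hc]
    exact lintegral_mono hvw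
  have hden : ∫⁻ θ, w θ ∂μ ≤ c * ∫⁻ θ, v θ ∂μ := by
    rw [← lintegral_const_mul' _ _ hc]
    exact lintegral_mono hwv
  have hinv : (∫⁻ θ, v θ ∂μ)⁻¹ ≤ c * (∫⁻ θ, w θ ∂μ)⁻¹ := by
    calc (∫⁻ θ, v θ ∂μ)⁻¹ = c * (c * ∫⁻ θ, v θ ∂μ)⁻¹ := by
          rw [ENNReal.mul_inv (Or.inl hc0) (Or.inl hc), ← mul_assoc,
            ENNReal.mul_inv_cancel hc0 hc, one_mul]
      _ ≤ _ := by gcongr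
  rw [div_eq_mul_inv, div_eq_mul_inv]
  exact (mul_le_mul' hnum hinv).trans (mul_mul_mul_comm _ _ _ _).le

lemma ofReal_exp_mul_le {x y d a : ℝ} (ha : 0 ≤ a) (hxy : x ≤ d + y) :
    ENNReal.ofReal (Real.exp x * a) ≤
      ENNReal.ofReal (Real.exp d) * ENNReal.ofReal (Real.exp y * a) := by
  rw [← ENNReal.ofReal_mul (Real.exp_nonneg _), ← mul_assoc, ← Real.exp_add]
  gcongr

/-- If two potentials differ by at most `ε / 2`, the Gibbs measures they define relative to the
same prior density assign to every set probabilities that agree up to a factor `exp ε`. -/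
lemma gibbs_prob_le_exp_mul {Θ : Type*} [MeasurableSpace Θ] (μ : Measure Θ) {h G G' : Θ → ℝ}
    {ε : ℝ} (hh : ∀ θ, 0 ≤ h θ) (hG : ∀ θ, |G θ - G' θ| ≤ ε / 2) (Z : Set Θ) :
    (∫⁻ θ in Z, ENNReal.ofReal (Real.exp (-G θ) * h θ) ∂μ) /
        (∫⁻ θ, ENNReal.ofReal (Real.exp (-G θ) * h θ) ∂μ) ≤
      ENNReal.ofReal (Real.exp ε) *
        ((∫⁻ θ in Z, ENNReal.ofReal (Real.exp (-G' θ) * h θ) ∂μ) /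
          (∫⁻ θ, ENNReal.ofReal (Real.exp (-G' θ) * h θ) ∂μ)) := by
  have hsq : ENNReal.ofReal (Real.exp ε) =
      ENNReal.ofReal (Real.exp (ε / 2)) * ENNReal.ofReal (Real.exp (ε / 2)) := by
    rw [← ENNReal.ofReal_mul (Real.exp_nonneg _), ← Real.exp_add, add_halves]
  rw [hsq]
  refine setLIntegral_div_lintegral_le μ (by simp [Real.exp_pos]) ENNReal.ofReal_ne_top
    (fun θ => ofReal_exp_mul_le (hh θ) ?_) (fun θ => ofReal_exp_mul_le (hh θ) ?_) Z <;>
  linarith [abs_le.mp (hG θ)]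

/-- Proposition 1 of the paper: the posterior-sampling training algorithm of PPMTF
provides `ε`-differential privacy with
`ε = α (min{3λᴵ, λᴵ+ρᴵ} (r_maxᴵ+κ)² + min{3λᴵᴵ, λᴵᴵ+ρᴵᴵ} (r_maxᴵᴵ+κ)²)`:
for two neighboring training sets with observed tensor entries bounded in `[0, r_max]`,
reconstructed entries bounded in `[-κ, r_max+κ]`, and at most the stated numbers of
differing summands, the two normalized posteriors (with density proportional to
`exp (-G) · h`) are within a factor `e^ε` of each other on every measurable set. -/
theorem ppmtf_posterior_sampling_dp
    {Θ : Type*} [MeasurableSpace Θ] (μ : Measure Θ)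
    (α κ rmaxI rmaxII : ℝ) (hα : 0 ≤ α) (hκ : 0 ≤ κ)
    (hrmaxI : 0 ≤ rmaxI) (hrmaxII : 0 ≤ rmaxII)
    (lamI lamII rhoI rhoII : ℕ) (ε : ℝ)
    (hε : ε = α * ((min (3 * lamI) (lamI + rhoI) : ℕ) * (rmaxI + κ) ^ 2
      + (min (3 * lamII) (lamII + rhoII) : ℕ) * (rmaxII + κ) ^ 2))
    {ι₁ ι₂ : Type*} [DecidableEq ι₁] [DecidableEq ι₂]
    (OI OI' : Finset ι₁) (OII OII' : Finset ι₂)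
    (rI rI' : ι₁ → ℝ) (rII rII' : ι₂ → ℝ)
    (hrI : ∀ i ∈ OI, rI i ∈ Set.Icc 0 rmaxI)
    (hrI' : ∀ i ∈ OI', rI' i ∈ Set.Icc 0 rmaxI)
    (hrII : ∀ j ∈ OII, rII j ∈ Set.Icc 0 rmaxII)
    (hrII' : ∀ j ∈ OII', rII' j ∈ Set.Icc 0 rmaxII)
    (rhatI : ι₁ → Θ → ℝ) (rhatII : ι₂ → Θ → ℝ)
    (hrhatImeas : ∀ i, Measurable (rhatI i))
    (hrhatIImeas : ∀ j, Measurable (rhatII j))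
    (hrhatI : ∀ i θ, rhatI i θ ∈ Set.Icc (-κ) (rmaxI + κ))
    (hrhatII : ∀ j θ, rhatII j θ ∈ Set.Icc (-κ) (rmaxII + κ))
    (h : Θ → ℝ) (hhmeas : Measurable h) (hhnonneg : ∀ θ, 0 ≤ h θ)
    (G G' : Θ → ℝ)
    (hG : G = fun θ => (∑ i ∈ OI, α / 2 * (rI i - rhatI i θ) ^ 2)
      + ∑ j ∈ OII, α / 2 * (rII j - rhatII j θ) ^ 2)
    (hG' : G' = fun θ => (∑ i ∈ OI', α / 2 * (rI' i - rhatI i θ) ^ 2)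
      + ∑ j ∈ OII', α / 2 * (rII' j - rhatII j θ) ^ 2)
    (hdiffI : {i | i ∈ OI ∪ OI' ∧ (¬(i ∈ OI ∧ i ∈ OI') ∨ rI i ≠ rI' i)}.ncard
      ≤ min (3 * lamI) (lamI + rhoI))
    (hdiffII : {j | j ∈ OII ∪ OII' ∧ (¬(j ∈ OII ∧ j ∈ OII') ∨ rII j ≠ rII' j)}.ncard
      ≤ min (3 * lamII) (lamII + rhoII))
    (hGpos : 0 < ∫⁻ θ, ENNReal.ofReal (Real.exp (-G θ) * h θ) ∂μ)
    (hGfin : ∫⁻ θ, ENNReal.ofReal (Real.exp (-G θ) * h θ) ∂μ < ⊤)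
    (hG'pos : 0 < ∫⁻ θ, ENNReal.ofReal (Real.exp (-G' θ) * h θ) ∂μ)
    (hG'fin : ∫⁻ θ, ENNReal.ofReal (Real.exp (-G' θ) * h θ) ∂μ < ⊤)
    (Z : Set Θ) (hZ : MeasurableSet Z) :
    ENNReal.ofReal (Real.exp (-ε)) *
        ((∫⁻ θ in Z, ENNReal.ofReal (Real.exp (-G' θ) * h θ) ∂μ) /
          (∫⁻ θ, ENNReal.ofReal (Real.exp (-G' θ) * h θ) ∂μ)) ≤
      (∫⁻ θ in Z, ENNReal.ofReal (Real.exp (-G θ) * h θ) ∂μ) /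
        (∫⁻ θ, ENNReal.ofReal (Real.exp (-G θ) * h θ) ∂μ) ∧
    (∫⁻ θ in Z, ENNReal.ofReal (Real.exp (-G θ) * h θ) ∂μ) /
        (∫⁻ θ, ENNReal.ofReal (Real.exp (-G θ) * h θ) ∂μ) ≤
      ENNReal.ofReal (Real.exp ε) *
        ((∫⁻ θ in Z, ENNReal.ofReal (Real.exp (-G' θ) * h θ) ∂μ) /
          (∫⁻ θ, ENNReal.ofReal (Real.exp (-G' θ) * h θ) ∂μ)) := by
  have hdist : ∀ θ, |G θ - G' θ| ≤ ε / 2 := by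
    intro θ
    have hI := abs_sum_half_mul_sub_sq_sub_le hα hrI hrI' (fun i => hrhatI i θ) hdiffI
    have hII := abs_sum_half_mul_sub_sq_sub_le hα hrII hrII' (fun j => hrhatII j θ) hdiffII
    rw [hG, hG', add_sub_add_comm]
    refine (abs_add_le _ _).trans ((add_le_add hI hII).trans_eq ?_)
    rw [hε]
    ring
  refine ⟨?_, gibbs_prob_le_exp_mul μ hhnonneg hdist Z⟩
  have hle := gibbs_prob_le_exp_mul μ hhnonneg (fun θ => abs_sub_comm (G θ) (G' θ) ▸ hdist θ) Z
  refine (mul_le_mul_right hle _).trans_eq ?_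
  rw [← mul_assoc, ← ENNReal.ofReal_mul (Real.exp_nonneg _), ← Real.exp_add, neg_add_cancel,
    Real.exp_zero, ENNReal.ofReal_one, one_mul]
end

section
/- Fix α ≥ 0, κ ≥ 0, r_max^I ≥ 1, r_max^II ≥ 1. Let (Θ, 𝒜, μ) be a measure space with a measurable prior density h : Θ → [0,∞). Let O^I and O^II be finite index sets, with counts r^I_i, r'^I_i ∈ [0, r_max^I] for i ∈ O^I and r^II_j, r'^II_j ∈ [0, r_max^II] for j ∈ O^II, and measurable maps r̂^I_i, r̂^II_j : Θ → ℝ satisfying r̂^I_i(θ) ∈ [−κ, r_max^I+κ] and r̂^II_j(θ) ∈ [−κ, r_max^II+κ] for all θ. Define G(θ) = Σ_{i∈O^I} (α/2)(r^I_i − r̂^I_i(θ))² + Σ_{j∈O^II} (α/2)(r^II_j − r̂^II_j(θ))² and G'(θ) analogously with the primed counts. Suppose r^I and r'^I differ at no more than two indices, r^II and r'^II differ at no more than four indices, and at every differing index the two counts differ by at most 1. Then |G(θ) − G'(θ)| ≤ α(2·r_max^I + 4·r_max^II + 6κ − 3) for all θ ∈ Θ, and consequently, if 0 < ∫ exp(−G)·h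 dμ < ∞ and 0 < ∫ exp(−G')·h dμ < ∞, the normalized posteriors p and p' satisfy p(Z) ≤ e^{ε}·p'(Z) for every measurable Z, with ε = α(4·r_max^I + 8·r_max^II + 12κ − 6). -/
open MeasureTheory

/-- Changing a count in `[0, R]` by at most `1` changes its squared-error loss against a
reconstruction in `[-κ, R + κ]` by at most `α (R + κ - 1/2)`. -/
theorem abs_half_mul_sq_sub_sub_le {α κ R r r' x : ℝ} (hα : 0 ≤ α) (hκ : 0 ≤ κ) (hR : 1 ≤ R)
    (hr : r ∈ Set.Icc 0 R) (hr' : r' ∈ Set.Icc 0 R) (hx : x ∈ Set.Icc (-κ) (R + κ))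
    (hd : |r - r'| ≤ 1) :
    |α / 2 * (r - x) ^ 2 - α / 2 * (r' - x) ^ 2| ≤ α * (R + κ - 1 / 2) := by
  obtain ⟨hr0, hrR⟩ := hr
  obtain ⟨hr0', hrR'⟩ := hr'
  obtain ⟨hx0, hxR⟩ := hx
  have hsum : |r + r' - 2 * x| ≤ 2 * R + 2 * κ - |r - r'| := by
    rcases abs_cases (r - r') with h | h <;> rw [abs_le] <;> constructor <;> linarith [h.1, h.2]
  have hprod : |r - r'| * |r + r' - 2 * x| ≤ 2 * R + 2 * κ - 1 := by
    have := mul_le_mul_of_nonneg_left hsum (abs_nonneg (r - r'))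
    nlinarith [mul_nonneg (sub_nonneg.2 hd) (by linarith : 0 ≤ 2 * R + 2 * κ - 1 - |r - r'|)]
  have hfac : α / 2 * (r - x) ^ 2 - α / 2 * (r' - x) ^ 2
      = α / 2 * ((r - r') * (r + r' - 2 * x)) := by ring
  rw [hfac, abs_mul, abs_mul (r - r'), abs_of_nonneg (by linarith : 0 ≤ α / 2)]
  linarith [mul_le_mul_of_nonneg_left hprod (by linarith : 0 ≤ α / 2)]

/-- If two families differ at no more than `k` indices, by at most `C` at each of them, then
their sums differ by at most `k * C`. -/
theorem Finset.abs_sum_sub_sum_le_of_ncard_le {ι : Type*} (s : Finset ι) (p : ι → Prop)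
    (f g : ι → ℝ) {C : ℝ} (hC : 0 ≤ C) {k : ℕ} (hk : {i | i ∈ s ∧ p i}.ncard ≤ k)
    (hp : ∀ i ∈ s, p i → |f i - g i| ≤ C) (hnp : ∀ i ∈ s, ¬ p i → f i = g i) :
    |∑ i ∈ s, f i - ∑ i ∈ s, g i| ≤ k * C := by
  classical
  have hcard : (s.filter p).card ≤ k := by
    rw [← Set.ncard_coe_finset, Finset.coe_filter]
    exact hk
  rw [← Finset.sum_sub_distrib, ← Finset.sum_filter_add_sum_filter_not s p,
    Finset.sum_eq_zero (s := s.filter fun i => ¬ p i) fun i hi => by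
      rw [Finset.mem_filter] at hi
      rw [hnp i hi.1 hi.2, sub_self], add_zero]
  calc |∑ i ∈ s.filter p, (f i - g i)| ≤ ∑ i ∈ s.filter p, |f i - g i| :=
        Finset.abs_sum_le_sum_abs _ _
    _ ≤ (s.filter p).card • C := Finset.sum_le_card_nsmul _ _ _ fun i hi => by
        rw [Finset.mem_filter] at hi
        exact hp i hi.1 hi.2
    _ = (s.filter p).card * C := nsmul_eq_mul _ _
    _ ≤ k * C := by gcongr

/-- The total loss changes by at most `k α (R + κ - 1/2)` when at most `k` counts change, each
by at most `1`. -/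
theorem abs_sum_half_mul_sq_sub_sub_le {ι : Type*} (s : Finset ι) {α κ R : ℝ} (r r' x : ι → ℝ)
    (hα : 0 ≤ α) (hκ : 0 ≤ κ) (hR : 1 ≤ R)
    (hr : ∀ i ∈ s, r i ∈ Set.Icc 0 R) (hr' : ∀ i ∈ s, r' i ∈ Set.Icc 0 R)
    (hx : ∀ i, x i ∈ Set.Icc (-κ) (R + κ)) {k : ℕ}
    (hk : {i | i ∈ s ∧ r i ≠ r' i}.ncard ≤ k)
    (hd : ∀ i ∈ s, r i ≠ r' i → |r i - r' i| ≤ 1) :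
    |∑ i ∈ s, α / 2 * (r i - x i) ^ 2 - ∑ i ∈ s, α / 2 * (r' i - x i) ^ 2|
      ≤ k * (α * (R + κ - 1 / 2)) :=
  s.abs_sum_sub_sum_le_of_ncard_le (fun i => r i ≠ r' i) _ _
    (mul_nonneg hα (by linarith)) hk
    (fun i hi hne => abs_half_mul_sq_sub_sub_le hα hκ hR (hr i hi) (hr' i hi) (hx i) (hd i hi hne))
    fun i _ heq => by rw [not_ne_iff.1 heq]

/-- If `G' ≤ G + c` pointwise, the unnormalized posterior mass for `G` is at most `exp c` times
that for `G'`. -/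
theorem lintegral_exp_neg_mul_le {Θ : Type*} [MeasurableSpace Θ] (μ : Measure Θ)
    {G G' h : Θ → ℝ} {c : ℝ} (hh : ∀ θ, 0 ≤ h θ) (hG : ∀ θ, G' θ ≤ G θ + c) :
    ∫⁻ θ, ENNReal.ofReal (Real.exp (-G θ) * h θ) ∂μ
      ≤ ENNReal.ofReal (Real.exp c) * ∫⁻ θ, ENNReal.ofReal (Real.exp (-G' θ) * h θ) ∂μ := by
  rw [← lintegral_const_mul' _ _ ENNReal.ofReal_ne_top]
  refine lintegral_mono fun θ => ?_
  rw [← ENNReal.ofReal_mul (Real.exp_nonneg c), ← mul_assoc, ← Real.exp_add]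
  refine ENNReal.ofReal_le_ofReal (mul_le_mul_of_nonneg_right (Real.exp_le_exp.2 ?_) (hh θ))
  linarith [hG θ]

/-- Single-location differential-privacy analysis (Appendix F): if the two count vectors
differ at no more than two indices of the transition-count tensor and no more than four
indices of the visit-count tensor, each by at most `1`, then
`|G(θ) - G'(θ)| ≤ α(2 r_maxᴵ + 4 r_maxᴵᴵ + 6κ - 3)` for all `θ`, and the normalized
posteriors satisfy `p(Z) ≤ e^ε · p'(Z)` with `ε = α(4 r_maxᴵ + 8 r_maxᴵᴵ + 12κ - 6)`. -/
theorem ppmtf_single_location_dp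
    {Θ : Type*} [MeasurableSpace Θ] (μ : Measure Θ)
    (α κ rmaxI rmaxII : ℝ) (hα : 0 ≤ α) (hκ : 0 ≤ κ)
    (hrmaxI : 1 ≤ rmaxI) (hrmaxII : 1 ≤ rmaxII)
    {ι₁ ι₂ : Type*} (OI : Finset ι₁) (OII : Finset ι₂)
    (rI rI' : ι₁ → ℝ) (rII rII' : ι₂ → ℝ)
    (hrI : ∀ i ∈ OI, rI i ∈ Set.Icc 0 rmaxI)
    (hrI' : ∀ i ∈ OI, rI' i ∈ Set.Icc 0 rmaxI)
    (hrII : ∀ j ∈ OII, rII j ∈ Set.Icc 0 rmaxII)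
    (hrII' : ∀ j ∈ OII, rII' j ∈ Set.Icc 0 rmaxII)
    (rhatI : ι₁ → Θ → ℝ) (rhatII : ι₂ → Θ → ℝ)
    (hrhatImeas : ∀ i, Measurable (rhatI i))
    (hrhatIImeas : ∀ j, Measurable (rhatII j))
    (hrhatI : ∀ i θ, rhatI i θ ∈ Set.Icc (-κ) (rmaxI + κ))
    (hrhatII : ∀ j θ, rhatII j θ ∈ Set.Icc (-κ) (rmaxII + κ))
    (h : Θ → ℝ) (hhmeas : Measurable h) (hhnonneg : ∀ θ, 0 ≤ h θ)
    (G G' : Θ → ℝ)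
    (hG : G = fun θ => (∑ i ∈ OI, α / 2 * (rI i - rhatI i θ) ^ 2)
      + ∑ j ∈ OII, α / 2 * (rII j - rhatII j θ) ^ 2)
    (hG' : G' = fun θ => (∑ i ∈ OI, α / 2 * (rI' i - rhatI i θ) ^ 2)
      + ∑ j ∈ OII, α / 2 * (rII' j - rhatII j θ) ^ 2)
    (hdiffI : {i | i ∈ OI ∧ rI i ≠ rI' i}.ncard ≤ 2)
    (hdiffII : {j | j ∈ OII ∧ rII j ≠ rII' j}.ncard ≤ 4)
    (hsmallI : ∀ i ∈ OI, rI i ≠ rI' i → |rI i - rI' i| ≤ 1)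
    (hsmallII : ∀ j ∈ OII, rII j ≠ rII' j → |rII j - rII' j| ≤ 1) :
    (∀ θ, |G θ - G' θ| ≤ α * (2 * rmaxI + 4 * rmaxII + 6 * κ - 3)) ∧
    (0 < ∫⁻ θ, ENNReal.ofReal (Real.exp (-G θ) * h θ) ∂μ →
     ∫⁻ θ, ENNReal.ofReal (Real.exp (-G θ) * h θ) ∂μ < ⊤ →
     0 < ∫⁻ θ, ENNReal.ofReal (Real.exp (-G' θ) * h θ) ∂μ →
     ∫⁻ θ, ENNReal.ofReal (Real.exp (-G' θ) * h θ) ∂μ < ⊤ →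
     ∀ Z : Set Θ, MeasurableSet Z →
       (∫⁻ θ in Z, ENNReal.ofReal (Real.exp (-G θ) * h θ) ∂μ) /
           (∫⁻ θ, ENNReal.ofReal (Real.exp (-G θ) * h θ) ∂μ) ≤
         ENNReal.ofReal (Real.exp (α * (4 * rmaxI + 8 * rmaxII + 12 * κ - 6))) *
           ((∫⁻ θ in Z, ENNReal.ofReal (Real.exp (-G' θ) * h θ) ∂μ) /
             (∫⁻ θ, ENNReal.ofReal (Real.exp (-G' θ) * h θ) ∂μ))) := by
  have hbound : ∀ θ, |G θ - G' θ| ≤ α * (2 * rmaxI + 4 * rmaxII + 6 * κ - 3) := by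
    intro θ
    have h₁ := abs_le.1 <| abs_sum_half_mul_sq_sub_sub_le OI rI rI' (fun i => rhatI i θ)
      hα hκ hrmaxI hrI hrI' (fun i => hrhatI i θ) hdiffI hsmallI
    have h₂ := abs_le.1 <| abs_sum_half_mul_sq_sub_sub_le OII rII rII' (fun j => rhatII j θ)
      hα hκ hrmaxII hrII hrII' (fun j => hrhatII j θ) hdiffII hsmallII
    push_cast at h₁ h₂
    simp only [hG, hG']
    rw [abs_le]
    constructor <;> linarith [h₁.1, h₁.2, h₂.1, h₂.2]
  refine ⟨hbound, fun _ _ hD' hD'top Z _ => ?_⟩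
  have hε : ENNReal.ofReal (Real.exp (α * (4 * rmaxI + 8 * rmaxII + 12 * κ - 6)))
      = ENNReal.ofReal (Real.exp (α * (2 * rmaxI + 4 * rmaxII + 6 * κ - 3)))
        * ENNReal.ofReal (Real.exp (α * (2 * rmaxI + 4 * rmaxII + 6 * κ - 3))) := by
    rw [← ENNReal.ofReal_mul (Real.exp_nonneg _), ← Real.exp_add]
    ring_nf
  have hnum := lintegral_exp_neg_mul_le (μ.restrict Z) (G := G) (G' := G')
    (c := α * (2 * rmaxI + 4 * rmaxII + 6 * κ - 3)) hhnonneg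
    fun θ => by linarith [(abs_le.1 (hbound θ)).1]
  have hden := lintegral_exp_neg_mul_le μ (G := G') (G' := G)
    (c := α * (2 * rmaxI + 4 * rmaxII + 6 * κ - 3)) hhnonneg
    fun θ => by linarith [(abs_le.1 (hbound θ)).2]
  rw [hε]
  generalize ENNReal.ofReal (Real.exp (α * (2 * rmaxI + 4 * rmaxII + 6 * κ - 3))) = c at *
  generalize ∫⁻ θ in Z, ENNReal.ofReal (Real.exp (-G θ) * h θ) ∂μ = N at *
  generalize ∫⁻ θ in Z, ENNReal.ofReal (Real.exp (-G' θ) * h θ) ∂μ = N' at *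
  generalize ∫⁻ θ, ENNReal.ofReal (Real.exp (-G θ) * h θ) ∂μ = D at *
  generalize ∫⁻ θ, ENNReal.ofReal (Real.exp (-G' θ) * h θ) ∂μ = D' at *
  refine ENNReal.div_le_of_le_mul ?_
  calc N ≤ c * N' := hnum
    _ = c * (N' / D') * D' := by
        rw [mul_assoc, ENNReal.div_mul_cancel hD'.ne' hD'top.ne]
    _ ≤ c * (N' / D') * (c * D) := by gcongr
    _ = c * c * (N' / D') * D := by ring
end

section
/- Let N, k ∈ ℕ with 1 ≤ k ≤ N, let η ≥ 0, and let p : Fin N → ℝ be a function assigning to each training user index m the probability p(m) that the generative model with input m outputs a fixed synthetic trace y. Let n ∈ Fin N and i ∈ ℕ satisfy e^{−(i+1)η} < p(n) ≤ e^{−iη}, and suppose that the set K = { m ∈ Fin N : e^{−(i+1)η} < p(m) ≤ e^{−iη} } has cardinality at least k. Then there exist k−1 pairwise distinct indices d₂, …, d_k ∈ Fin N, all different from n, such that, setting d₁ = n, for all a, b ∈ {1, …, k}: e^{−η}·p(d_b) ≤ p(d_a) ≤ e^{η}·p(d_b). -/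
/-- If a finite set has at least `k` elements, then some injective family indexed by `Fin k` takes
values in it and takes a prescribed value in it at a prescribed index. -/
theorem Set.Finite.exists_injective_fin_apply_eq {α : Type*} {s : Set α} (hs : s.Finite) {k : ℕ}
    (hk : k ≤ s.ncard) {x : α} (hx : x ∈ s) (j : Fin k) :
    ∃ d : Fin k → α, d j = x ∧ Function.Injective d ∧ ∀ a, d a ∈ s := by
  classical
  have := hs.to_subtype
  rw [← Nat.card_coe_set_eq] at hk
  let f : Fin k → s := fun a => (Finite.equivFin s).symm (Fin.castLE hk a)
  have hf : Function.Injective f :=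
    (Finite.equivFin s).symm.injective.comp (Fin.castLE_injective hk)
  exact ⟨fun a => Equiv.swap (f j) ⟨x, hx⟩ (f a), by simp,
    Subtype.val_injective.comp ((Equiv.injective _).comp hf), fun a => Subtype.coe_prop _⟩

/-- Two reals in the same bucket `(e^{-(t+1)η}, e^{-tη}]` are within a factor `e^η`. -/
theorem le_exp_mul_of_mem_bucket {η t x y : ℝ} (hx : x ≤ Real.exp (-t * η))
    (hy : Real.exp (-(t + 1) * η) < y) : x ≤ Real.exp η * y :=
  calc x ≤ Real.exp (-t * η) := hx
    _ = Real.exp η * Real.exp (-(t + 1) * η) := by rw [← Real.exp_add]; ring_nf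
    _ ≤ Real.exp η * y := by gcongr

/-- Passing the deterministic privacy test (Privacy Test 1) implies
`(k, η)`-plausible deniability: if `e^{-(i+1)η} < p n ≤ e^{-iη}` and at least `k`
user indexes `m` satisfy `e^{-(i+1)η} < p m ≤ e^{-iη}`, then there is an injective
family `d : Fin k → Fin N` with `d 0 = n` whose probabilities are pairwise within a
factor `e^η` of each other. -/
theorem privacy_test_implies_plausible_deniability
    (N k : ℕ) (hk : 1 ≤ k) (hkN : k ≤ N) (η : ℝ) (hη : 0 ≤ η)
    (p : Fin N → ℝ) (n : Fin N) (i : ℕ)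
    (hlow : Real.exp (-((i : ℝ) + 1) * η) < p n)
    (hhigh : p n ≤ Real.exp (-(i : ℝ) * η))
    (hK : k ≤ Set.ncard {m : Fin N |
      Real.exp (-((i : ℝ) + 1) * η) < p m ∧ p m ≤ Real.exp (-(i : ℝ) * η)}) :
    ∃ d : Fin k → Fin N, d ⟨0, hk⟩ = n ∧ Function.Injective d ∧
      ∀ a b : Fin k,
        Real.exp (-η) * p (d b) ≤ p (d a) ∧ p (d a) ≤ Real.exp η * p (d b) := by
  obtain ⟨d, hd, hinj, hmem⟩ := (Set.toFinite _).exists_injective_fin_apply_eq hK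
    (x := n) ⟨hlow, hhigh⟩ ⟨0, hk⟩
  refine ⟨d, hd, hinj, fun a b => ⟨?_, le_exp_mul_of_mem_bucket (hmem a).2 (hmem b).1⟩⟩
  rw [Real.exp_neg, inv_mul_le_iff₀ (Real.exp_pos η)]
  exact le_exp_mul_of_mem_bucket (hmem b).2 (hmem a).1
end
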